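/- Let A be an associative ℂ-algebra containing elements E^l_m for 1 ≤ l ≤ N and m ∈ ℤ∖{0}, and parameters q, p, p* ∈ ℂ^× with c ∈ ℂ, satisfying: [E^l_m, E^l_n] = δ_{m+n,0} ([cm]_q [(N−1)m]_q (q^m − q^{-m})² / (m [m]_q [Nm]_q)) · ((1−p^m)/(1−p*^m)) q^{-cm}, and for k ≠ l: [E^k_m, E^l_n] = −δ_{m+n,0} q^{−sgn(k−l)Nm + (k−l)m} ([cm]_q (q^m−q^{-m})²/(m[Nm]_q)) · ((1−p^m)/(1−p*^m)) q^{-cm} (all denominators assumed nonzero). Define α_{j,m} = (E^j_m − q^{-m}E^{j+1}_m)/(q − q^{-1}) for 1 ≤ j ≤ N−1. Then [α_{i,m}, α_{j,n}] = δ_{m+n,0} ([a_{ij}m]_q [cm]_q / m) · ((1−p^m)/(1−p*^m)) · q^{-cm}, where (a_{ij}) is the Cartan matrix of sl_N, i.e. a_{ii} = 2, a_{ij} = −1 if |i−j| = 1, a_{ij} = 0 otherwise. -/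

import Mathlib

/-- `[x]_q = (q^x - q^{-x})/(q - q^{-1})` for complex exponent `x` (via `cpow`). -/
noncomputable def qNumC (q x : ℂ) : ℂ := (q ^ x - q ^ (-x)) / (q - q⁻¹)

/-- The Cartan matrix of `sl_N` (as a function of indices in `{1,…,N-1}`). -/
def cartanSL (i j : ℕ) : ℤ :=
  if i = j then 2 else if (i : ℤ) - (j : ℤ) = 1 ∨ (j : ℤ) - (i : ℤ) = 1 then -1 else 0

open Complex in
theorem qNumC_intCast (q : ℂ) (m : ℤ) :
    qNumC q (m : ℂ) = (q ^ m - (q ^ m)⁻¹) / (q - q⁻¹) := by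
  rw [qNumC, cpow_neg, cpow_intCast]

/-- The scalar part of `[E^k_m, E^l_{-m}]`, as a function of `d = k - l` and `x = q ^ m`. -/
noncomputable def pairCoeff (x : ℂ) (N : ℕ) (d : ℤ) : ℂ :=
  if d = 0 then (x ^ ((N : ℤ) - 1) - (x ^ ((N : ℤ) - 1))⁻¹) / (x - x⁻¹)
  else -x ^ (-d.sign * N + d)

theorem pairCoeff_second_difference (x : ℂ) (hx : x ≠ 0) (hxx : x - x⁻¹ ≠ 0) (N i j : ℕ) :
    2 * pairCoeff x N ((i : ℤ) - j) - x * pairCoeff x N ((i : ℤ) - j - 1)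
        - x⁻¹ * pairCoeff x N ((i : ℤ) - j + 1) =
      (x ^ (N : ℤ) - (x ^ (N : ℤ))⁻¹) * (x ^ cartanSL i j - (x ^ cartanSL i j)⁻¹)
        / (x - x⁻¹) ^ 2 := by
  have hy : x ^ N ≠ 0 := pow_ne_zero _ hx
  have hsign : Int.sign 2 = 1 := rfl
  have hx2 : x ^ 2 - 1 ≠ 0 := by
    intro h
    apply hxx
    field_simp
    simpa using h
  generalize hd : (i : ℤ) - j = d
  have hcartan : cartanSL i j = if d = 0 then 2 else if d = 1 ∨ d = -1 then -1 else 0 := by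
    unfold cartanSL
    split_ifs <;> first | rfl | omega
  rw [hcartan]
  obtain rfl | rfl | rfl | h | h : d = 0 ∨ d = 1 ∨ d = -1 ∨ 2 ≤ d ∨ d ≤ -2 := by omega
  · simp [pairCoeff, zpow_add₀ hx, zpow_sub₀ hx, zpow_neg]
    generalize x ^ N = y at *
    field_simp
    ring
  · simp [pairCoeff, hsign, zpow_add₀ hx, zpow_sub₀ hx, zpow_neg]
    generalize x ^ N = y at *
    field_simp
    ring
  · simp [pairCoeff, hsign, zpow_add₀ hx, zpow_sub₀ hx, zpow_neg]
    generalize x ^ N = y at *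
    field_simp
    ring
  · have h0 : d ≠ 0 := by omega
    have h1 : d - 1 ≠ 0 := by omega
    have h2 : d + 1 ≠ 0 := by omega
    have h3 : ¬(d = 1 ∨ d = -1) := by omega
    simp only [pairCoeff, h0, h1, h2, h3, if_false,
      Int.sign_eq_one_of_pos (show 0 < d by omega),
      Int.sign_eq_one_of_pos (show 0 < d - 1 by omega),
      Int.sign_eq_one_of_pos (show 0 < d + 1 by omega), zpow_add₀ hx, zpow_sub₀ hx,
      zpow_one, zpow_zero]
    field_simp
    ring
  · have h0 : d ≠ 0 := by omega
    have h1 : d - 1 ≠ 0 := by omega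
    have h2 : d + 1 ≠ 0 := by omega
    have h3 : ¬(d = 1 ∨ d = -1) := by omega
    simp only [pairCoeff, h0, h1, h2, h3, if_false,
      Int.sign_eq_neg_one_of_neg (show d < 0 by omega),
      Int.sign_eq_neg_one_of_neg (show d - 1 < 0 by omega),
      Int.sign_eq_neg_one_of_neg (show d + 1 < 0 by omega), zpow_add₀ hx, zpow_sub₀ hx,
      zpow_one, zpow_zero]
    field_simp
    ring

/-- Bilinear expansion of the commutator of two differences `r • (a - s • b)`. -/
theorem commutator_smul_sub {A : Type*} [Ring A] [Algebra ℂ A] (a b a' b' : A) (r s t : ℂ) :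
    r • (a - s • b) * r • (a' - t • b') - r • (a' - t • b') * r • (a - s • b) =
      (r * r) • ((a * a' - a' * a) - t • (a * b' - b' * a) - s • (b * a' - a' * b)
        + (s * t) • (b * b' - b' * b)) := by
  simp only [smul_sub, smul_add, sub_mul, mul_sub, smul_mul_assoc, mul_smul_comm, smul_smul]
  module

theorem alpha_commutation (A : Type*) [Ring A] [Algebra ℂ A]
    (N : ℕ) (E α : ℕ → ℤ → A) (q p pstar c : ℂ)
    (hq0 : q ≠ 0) (hp0 : p ≠ 0) (hps0 : pstar ≠ 0) (hqq : q - q⁻¹ ≠ 0)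
    (hden : ∀ m : ℤ, m ≠ 0 →
      (1 - pstar ^ m) ≠ 0 ∧ qNumC q ((m : ℂ)) ≠ 0 ∧ qNumC q ((N : ℂ) * (m : ℂ)) ≠ 0)
    (hdiag : ∀ l, 1 ≤ l → l ≤ N → ∀ m n : ℤ, m ≠ 0 → n ≠ 0 →
      E l m * E l n - E l n * E l m =
        ((if m + n = 0 then
            qNumC q (c * (m : ℂ)) * qNumC q (((N : ℂ) - 1) * (m : ℂ)) *
                (q ^ m - q ^ (-m)) ^ 2 /
                ((m : ℂ) * qNumC q ((m : ℂ)) * qNumC q ((N : ℂ) * (m : ℂ))) *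
              ((1 - p ^ m) / (1 - pstar ^ m)) * q ^ (-(c * (m : ℂ)))
          else 0) : ℂ) • (1 : A))
    (hoff : ∀ k l, 1 ≤ k → k ≤ N → 1 ≤ l → l ≤ N → k ≠ l → ∀ m n : ℤ, m ≠ 0 → n ≠ 0 →
      E k m * E l n - E l n * E k m =
        ((if m + n = 0 then
            -(q ^ (((-(Int.sign ((k : ℤ) - (l : ℤ))) * (N : ℤ) * m +
                ((k : ℤ) - (l : ℤ)) * m : ℤ) : ℂ)) *
                (qNumC q (c * (m : ℂ)) * (q ^ m - q ^ (-m)) ^ 2 /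
                  ((m : ℂ) * qNumC q ((N : ℂ) * (m : ℂ)))) *
              ((1 - p ^ m) / (1 - pstar ^ m)) * q ^ (-(c * (m : ℂ))))
          else 0) : ℂ) • (1 : A))
    (hα : ∀ j m, α j m = ((q - q⁻¹)⁻¹ : ℂ) • (E j m - (q ^ (-m) : ℂ) • E (j + 1) m)) :
    ∀ i j, 1 ≤ i → i ≤ N - 1 → 1 ≤ j → j ≤ N - 1 → ∀ m n : ℤ, m ≠ 0 → n ≠ 0 →
      α i m * α j n - α j n * α i m =
        ((if m + n = 0 then
            qNumC q (((cartanSL i j : ℤ) : ℂ) * (m : ℂ)) * qNumC q (c * (m : ℂ)) / (m : ℂ) *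
              ((1 - p ^ m) / (1 - pstar ^ m)) * q ^ (-(c * (m : ℂ)))
          else 0) : ℂ) • (1 : A) := by
  intro i j hi hiN hj hjN m n hm hn
  rw [hα, hα, commutator_smul_sub]
  have hcomm : ∀ k l, 1 ≤ k → k ≤ N → 1 ≤ l → l ≤ N → E k m * E l n - E l n * E k m =
      ((if m + n = 0 then
        qNumC q (c * m) * (q ^ m - q ^ (-m)) ^ 2 / (m * qNumC q (N * m)) *
          pairCoeff (q ^ m) N ((k : ℤ) - l) *
            ((1 - p ^ m) / (1 - pstar ^ m)) * q ^ (-(c * (m : ℂ))) else 0) : ℂ) • (1 : A) := by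
    intro k l hk hkN hl hlN
    have hqm := (hden m hm).2.1
    by_cases hkl : k = l
    · subst hkl
      rw [hdiag k hk hkN m n hm hn]
      congr 1
      split_ifs
      · have hcoeff : pairCoeff (q ^ m) N ((k : ℤ) - k) =
            qNumC q (((N : ℂ) - 1) * m) / qNumC q m := by
          have hcast : ((N : ℂ) - 1) * m = ((m * ((N : ℤ) - 1) : ℤ) : ℂ) := by
            push_cast
            ring
          rw [hcast, qNumC_intCast, qNumC_intCast, zpow_mul, div_div_div_cancel_right₀ hqq]
          simp [pairCoeff]
        rw [hcoeff]
        ring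
      · rfl
    · rw [hoff k l hk hkN hl hlN hkl m n hm hn]
      congr 1
      split_ifs
      · have hd : (k : ℤ) - l ≠ 0 := by omega
        rw [pairCoeff, if_neg hd, ← zpow_mul, Complex.cpow_intCast]
        rw [show m * (-((k : ℤ) - l).sign * N + (k - l)) =
          -((k : ℤ) - l).sign * N * m + (k - l) * m by ring]
        ring
      · rfl
  rw [hcomm i j hi (by omega) hj (by omega), hcomm i (j + 1) hi (by omega) (by omega) (by omega),
    hcomm (i + 1) j (by omega) (by omega) hj (by omega),
    hcomm (i + 1) (j + 1) (by omega) (by omega) (by omega) (by omega)]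
  simp only [smul_smul, ← sub_smul, ← add_smul]
  congr 1
  split_ifs with hmn
  · obtain rfl : n = -m := by omega
    obtain ⟨-, hqm, hqNm⟩ := hden m hm
    have hx : q ^ m ≠ 0 := zpow_ne_zero _ hq0
    have hcastN : (N : ℂ) * m = ((m * (N : ℤ) : ℤ) : ℂ) := by
      push_cast
      ring
    have hcasta : (cartanSL i j : ℂ) * m = ((m * cartanSL i j : ℤ) : ℂ) := by
      push_cast
      ring
    rw [hcastN, qNumC_intCast, zpow_mul] at hqNm
    rw [qNumC_intCast] at hqm
    rw [hcastN, hcasta, qNumC_intCast q (m * (N : ℤ)), qNumC_intCast q (m * cartanSL i j),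
      zpow_mul, zpow_mul, neg_neg, zpow_neg]
    have hxx := (div_ne_zero_iff.mp hqm).1
    have hyy := (div_ne_zero_iff.mp hqNm).1
    have key := pairCoeff_second_difference (q ^ m) hx hxx N i j
    push_cast
    rw [show (i : ℤ) - (j + 1) = i - j - 1 by ring, show (i : ℤ) + 1 - j = i - j + 1 by ring,
      show (i : ℤ) + 1 - (j + 1) = i - j by ring, inv_mul_cancel₀ hx]
    have hmC : (m : ℂ) ≠ 0 := by exact_mod_cast hm
    generalize (1 - p ^ m) / (1 - pstar ^ m) = R at *
    generalize qNumC q (c * m) = C at *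
    generalize q ^ (-(c * (m : ℂ))) = Q at *
    generalize (q ^ m) ^ cartanSL i j - ((q ^ m) ^ cartanSL i j)⁻¹ = Z at *
    generalize (q ^ m) ^ (N : ℤ) - ((q ^ m) ^ (N : ℤ))⁻¹ = Y at *
    generalize q ^ m - (q ^ m)⁻¹ = X at *
    generalize q - q⁻¹ = S at *
    generalize q ^ m = x at *
    calc _ = S⁻¹ * S⁻¹ * (C * X ^ 2 / (m * (Y / S))) * R * Q *
          (2 * pairCoeff x N (i - j) - x * pairCoeff x N (i - j - 1)
            - x⁻¹ * pairCoeff x N (i - j + 1)) := by ring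
      _ = _ := by
        rw [key]
        field_simp
  · simp
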